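/- (Staude's wire-model theorem.) Let 0 < c < b < a, let 𝓔 = {(x,y,z) ∈ ℝ³ : x²/a² + y²/b² + z²/c² = 1} be the ellipsoid, let C₃ = {(x,y,0) : x²/(a²−c²) + y²/(b²−c²) = 1} be the focal ellipse and C₂ = {(x,0,z) : x²/(a²−b²) − z²/(b²−c²) = 1} the focal hyperbola of its confocal system, let F₁ = (−√(a²−c²), 0, 0) be the left focus of the focal hyperbola and G₂ = (√(a²−b²), 0, 0) the right focus of the focal ellipse. Then for every point P ∈ 𝓔, the shortest total length of broken lines F₁ H P E G₂ with H ∈ C₂ and E ∈ C₃, namely inf { ‖F₁ − H‖ + ‖H − P‖ + ‖P − E‖ + ‖E − G₂‖ : H ∈ C₂, E ∈ C₃ }, equals 2a + √(a²−c²) − √(a²−b²); in particular it is independent of the position of P on the ellipsoid. -/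

import Mathlib

/-- Cauchy–Schwarz in the plane, with the norms given by their squares. -/
lemma mul_add_mul_le_of_sq_eq {x₁ y₁ x₂ y₂ r s : ℝ} (hr : 0 ≤ r) (hs : 0 ≤ s)
    (h₁ : r ^ 2 = x₁ ^ 2 + y₁ ^ 2) (h₂ : s ^ 2 = x₂ ^ 2 + y₂ ^ 2) :
    x₁ * x₂ + y₁ * y₂ ≤ r * s := by
  refine (abs_le_of_sq_le_sq' ?_ (mul_nonneg hr hs)).2
  rw [mul_pow, h₁, h₂]
  nlinarith [sq_nonneg (x₁ * y₂ - y₁ * x₂)]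

/-- Ivory's identity for the ellipsoid and its focal ellipse. -/
lemma focalEllipse_sq_dist_eq {a b c f g k u v w s p q : ℝ}
    (haf : a ^ 2 = c ^ 2 + f ^ 2) (hbk : b ^ 2 = c ^ 2 + k ^ 2)
    (hfg : f ^ 2 = g ^ 2 + k ^ 2) (hP : u ^ 2 + v ^ 2 + w ^ 2 = 1)
    (hs : s ^ 2 = (f * u + g) ^ 2 + (k * v) ^ 2) (hpq : p ^ 2 + q ^ 2 = 1) :
    (a * u - f * p) ^ 2 + (b * v - k * q) ^ 2 + (c * w) ^ 2 = (a + g * p - s) ^ 2 +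
      2 * ((a + g * p) * s - ((a * p + g) * (f * u + g) + (b * q) * (k * v))) := by
  linear_combination (-1) * hs + u ^ 2 * haf + v ^ 2 * hbk + c ^ 2 * hP + (p ^ 2 - 1) * hfg
    + k ^ 2 * hpq - haf

/-- The distance from `P = (a u, b v, c w)` to a point `E` of the focal ellipse, bounded below
through the distance `s` from the left focus of the focal ellipse to the point of the focal disc
corresponding to `P`. -/
lemma le_dist_focalEllipse {a b c f g k u v w s p q : ℝ} (hg : 0 < g) (hga : g < a)
    (haf : a ^ 2 = c ^ 2 + f ^ 2) (hbk : b ^ 2 = c ^ 2 + k ^ 2)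
    (hfg : f ^ 2 = g ^ 2 + k ^ 2) (hP : u ^ 2 + v ^ 2 + w ^ 2 = 1) (hs₀ : 0 ≤ s)
    (hs : s ^ 2 = (f * u + g) ^ 2 + (k * v) ^ 2) (hpq : p ^ 2 + q ^ 2 = 1) :
    a + g * p - s ≤ √((a * u - f * p) ^ 2 + (b * v - k * q) ^ 2 + (c * w) ^ 2) := by
  have hp : -1 ≤ p := by nlinarith [sq_nonneg q]
  have hr : 0 ≤ a + g * p := by nlinarith
  have hcs : (a * p + g) * (f * u + g) + (b * q) * (k * v) ≤ (a + g * p) * s := by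
    refine mul_add_mul_le_of_sq_eq hr hs₀ ?_ hs
    linear_combination (1 - p ^ 2) * (haf - hbk + hfg) - b ^ 2 * hpq
  refine Real.le_sqrt_of_sq_le ?_
  rw [focalEllipse_sq_dist_eq haf hbk hfg hP hs hpq]
  linarith

/-- The bound of `le_dist_focalEllipse` is attained. -/
lemma exists_dist_focalEllipse_eq {a b c f g k u v w s : ℝ} (hg : 0 < g) (hga : g < a)
    (haf : a ^ 2 = c ^ 2 + f ^ 2) (hbk : b ^ 2 = c ^ 2 + k ^ 2)
    (hfg : f ^ 2 = g ^ 2 + k ^ 2) (hP : u ^ 2 + v ^ 2 + w ^ 2 = 1) (hs₀ : 0 ≤ s)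
    (hs : s ^ 2 = (f * u + g) ^ 2 + (k * v) ^ 2) :
    ∃ p q : ℝ, p ^ 2 + q ^ 2 = 1 ∧
      √((a * u - f * p) ^ 2 + (b * v - k * q) ^ 2 + (c * w) ^ 2) = a + g * p - s := by
  suffices h : ∃ p q : ℝ, p ^ 2 + q ^ 2 = 1 ∧ s ≤ a + g * p ∧
      (a * p + g) * (f * u + g) + (b * q) * (k * v) = (a + g * p) * s by
    obtain ⟨p, q, hpq, hle, h⟩ := h
    refine ⟨p, q, hpq, ?_⟩
    rw [focalEllipse_sq_dist_eq haf hbk hfg hP hs hpq, h, sub_self, mul_zero, add_zero,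
      Real.sqrt_sq (by linarith)]
  have hab : a ^ 2 = g ^ 2 + b ^ 2 := by linear_combination haf - hbk + hfg
  rcases hs₀.eq_or_lt with rfl | hs₁
  · have h₁ : f * u + g = 0 := by nlinarith [sq_nonneg (f * u + g), sq_nonneg (k * v)]
    exact ⟨1, 0, by norm_num, by linarith, by rw [h₁]; ring⟩
  · have ha : 0 < a := hg.trans hga
    have hle : f * u + g ≤ s := (abs_le_of_sq_le_sq' (by nlinarith [sq_nonneg (k * v)]) hs₀).2
    have hd : 0 < a * s - g * (f * u + g) := by nlinarith
    have hu : f * u * (f * u) ≤ a * a := by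
      nlinarith [sq_nonneg (f * v), sq_nonneg (f * w), sq_nonneg c]
    have hsb : a * s - g * (f * u + g) ≤ b ^ 2 := by
      have h₁ : a * s ≤ a ^ 2 + g * (f * u) := by
        refine (abs_le_of_sq_le_sq' ?_ ?_).2
        · have h₂ : (a ^ 2 + g * (f * u)) ^ 2 - (a * s) ^ 2
              = b ^ 2 * (c ^ 2 * u ^ 2) + a ^ 2 * (c ^ 2 * v ^ 2) + a ^ 2 * (b ^ 2 * w ^ 2) := by
            linear_combination (a ^ 2 - f ^ 2 * u ^ 2) * hab - a ^ 2 * hs - a ^ 2 * b ^ 2 * hP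
              + b ^ 2 * u ^ 2 * haf + a ^ 2 * v ^ 2 * hbk
          have : 0 ≤ b ^ 2 * (c ^ 2 * u ^ 2) + a ^ 2 * (c ^ 2 * v ^ 2) + a ^ 2 * (b ^ 2 * w ^ 2) := by
            positivity
          linarith
        · have : -a ≤ f * u := (abs_le_of_sq_le_sq' (by nlinarith) ha.le).1
          nlinarith
      linarith
    refine ⟨(a * (f * u + g) - g * s) / (a * s - g * (f * u + g)),
      b * (k * v) / (a * s - g * (f * u + g)), ?_, ?_, ?_⟩
    · field_simp
      linear_combination ((f * u + g) ^ 2 - s ^ 2) * hab - b ^ 2 * hs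
    · have : a + g * ((a * (f * u + g) - g * s) / (a * s - g * (f * u + g)))
          = b ^ 2 / (a * s - g * (f * u + g)) * s := by
        field_simp
        linear_combination s * hab
      rw [this]
      exact le_mul_of_one_le_left hs₀ ((one_le_div hd).2 hsb)
    · field_simp
      linear_combination ((f * u + g) ^ 2 - s ^ 2) * hab - b ^ 2 * hs

/-- Ivory's identity for the ellipsoid and its focal hyperbola. -/
lemma focalHyperbola_sq_dist_eq {a b c f g k u v w s C S : ℝ}
    (haf : a ^ 2 = c ^ 2 + f ^ 2) (hbk : b ^ 2 = c ^ 2 + k ^ 2)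
    (hfg : f ^ 2 = g ^ 2 + k ^ 2) (hP : u ^ 2 + v ^ 2 + w ^ 2 = 1)
    (hs : s ^ 2 = (f * u + g) ^ 2 + (k * v) ^ 2) (hCS : C ^ 2 - S ^ 2 = 1) :
    (-g * C - a * u) ^ 2 + (b * v) ^ 2 + (k * S - c * w) ^ 2 = (a + s - f * C) ^ 2 +
      2 * ((a * C - f) * (f + g * u) - ((a - f * C) * s + (c * S) * (k * w))) := by
  linear_combination (-1) * hs + u ^ 2 * haf + v ^ 2 * hbk + c ^ 2 * hP - C ^ 2 * hfg
    - k ^ 2 * hCS - haf + hfg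

lemma focal_sq_eq {f g k u v w s : ℝ}
    (hfg : f ^ 2 = g ^ 2 + k ^ 2) (hP : u ^ 2 + v ^ 2 + w ^ 2 = 1)
    (hs : s ^ 2 = (f * u + g) ^ 2 + (k * v) ^ 2) :
    (f + g * u) ^ 2 = s ^ 2 + (k * w) ^ 2 := by
  linear_combination (1 - u ^ 2) * hfg - hs - k ^ 2 * hP

lemma focal_pos {f g u v w : ℝ} (hg : 0 < g) (hgf : g < f)
    (hP : u ^ 2 + v ^ 2 + w ^ 2 = 1) : 0 < f + g * u := by
  have : -1 ≤ u := by nlinarith [sq_nonneg v, sq_nonneg w]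
  nlinarith

/-- The distance from `P = (a u, b v, c w)` to a point of the left branch of the focal hyperbola,
bounded below. -/
lemma le_dist_focalHyperbola {a b c f g k u v w s C S : ℝ} (hg : 0 < g) (hgf : g < f)
    (hfa : f < a) (haf : a ^ 2 = c ^ 2 + f ^ 2) (hbk : b ^ 2 = c ^ 2 + k ^ 2)
    (hfg : f ^ 2 = g ^ 2 + k ^ 2) (hP : u ^ 2 + v ^ 2 + w ^ 2 = 1)
    (hs : s ^ 2 = (f * u + g) ^ 2 + (k * v) ^ 2) (hC : 0 ≤ C) (hCS : C ^ 2 - S ^ 2 = 1) :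
    a + s - f * C ≤ √((-g * C - a * u) ^ 2 + (b * v) ^ 2 + (k * S - c * w) ^ 2) := by
  have hC₁ : 1 ≤ C := by nlinarith [sq_nonneg S]
  have hcs : (a - f * C) * s + (c * S) * (k * w) ≤ (a * C - f) * (f + g * u) := by
    refine mul_add_mul_le_of_sq_eq (by nlinarith) (focal_pos hg hgf hP).le ?_
      (focal_sq_eq hfg hP hs)
    linear_combination (C ^ 2 - 1) * haf + c ^ 2 * hCS
  refine Real.le_sqrt_of_sq_le ?_
  rw [focalHyperbola_sq_dist_eq haf hbk hfg hP hs hCS]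
  linarith

/-- The bound of `le_dist_focalHyperbola` is attained. -/
lemma exists_dist_focalHyperbola_eq {a b c f g k u v w s : ℝ} (hg : 0 < g) (hgf : g < f)
    (hfa : f < a) (haf : a ^ 2 = c ^ 2 + f ^ 2) (hbk : b ^ 2 = c ^ 2 + k ^ 2)
    (hfg : f ^ 2 = g ^ 2 + k ^ 2) (hP : u ^ 2 + v ^ 2 + w ^ 2 = 1) (hs₀ : 0 ≤ s)
    (hs : s ^ 2 = (f * u + g) ^ 2 + (k * v) ^ 2) :
    ∃ C S : ℝ, 0 ≤ C ∧ C ^ 2 - S ^ 2 = 1 ∧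
      √((-g * C - a * u) ^ 2 + (b * v) ^ 2 + (k * S - c * w) ^ 2) = a + s - f * C := by
  have hW := focal_pos hg hgf hP
  have hW₂ := focal_sq_eq hfg hP hs
  set W := f + g * u with hW_def
  have hf : 0 < f := hg.trans hgf
  have ha : 0 < a := hf.trans hfa
  have hd : 0 < f * W + a * s := by positivity
  have hCS : ((a * W + f * s) / (f * W + a * s)) ^ 2 - (c * (k * w) / (f * W + a * s)) ^ 2 = 1 := by
    field_simp
    linear_combination (W ^ 2 - s ^ 2) * haf + c ^ 2 * hW₂
  refine ⟨(a * W + f * s) / (f * W + a * s), c * (k * w) / (f * W + a * s), by positivity, hCS, ?_⟩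
  rw [focalHyperbola_sq_dist_eq haf hbk hfg hP hs hCS, ← hW_def]
  have h₁ : a - f * ((a * W + f * s) / (f * W + a * s)) = c ^ 2 * s / (f * W + a * s) := by
    field_simp
    linear_combination s * haf
  have h₂ : a * ((a * W + f * s) / (f * W + a * s)) - f = c ^ 2 * W / (f * W + a * s) := by
    field_simp
    linear_combination W * haf
  have h₃ : 0 ≤ c ^ 2 * s / (f * W + a * s) := by positivity
  have h₄ : c ^ 2 * W / (f * W + a * s) * W - (c ^ 2 * s / (f * W + a * s) * s +
      c * (c * (k * w) / (f * W + a * s)) * (k * w)) = 0 := by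
    field_simp
    linear_combination c ^ 2 * hW₂
  rw [h₁, h₂, h₄, mul_zero, add_zero, Real.sqrt_sq (by linarith)]

/-- The distance from the left focus of the focal hyperbola to a point of its left branch. -/
lemma dist_focus_focalHyperbola {f g k C S : ℝ} (hgf : g < f) (hf : 0 < f)
    (hfg : f ^ 2 = g ^ 2 + k ^ 2) (hC : 0 ≤ C) (hCS : C ^ 2 - S ^ 2 = 1) :
    √((-f - -g * C) ^ 2 + (k * S) ^ 2) = f * C - g := by
  have hC₁ : 1 ≤ C := by nlinarith [sq_nonneg S]
  rw [← Real.sqrt_sq (show 0 ≤ f * C - g by nlinarith)]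
  congr 1
  linear_combination (1 - C ^ 2) * hfg - k ^ 2 * hCS

/-- The broken line from the left focus of the focal hyperbola to `P = (a u, b v, c w)` through a
point of either branch has length at least `a + s - g`. -/
lemma le_brokenLine_focalHyperbola {a b c f g k u v w s C S : ℝ} (hg : 0 < g) (hgf : g < f)
    (hfa : f < a) (haf : a ^ 2 = c ^ 2 + f ^ 2) (hbk : b ^ 2 = c ^ 2 + k ^ 2)
    (hfg : f ^ 2 = g ^ 2 + k ^ 2) (hP : u ^ 2 + v ^ 2 + w ^ 2 = 1)
    (hs : s ^ 2 = (f * u + g) ^ 2 + (k * v) ^ 2) (hCS : C ^ 2 - S ^ 2 = 1) :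
    a + s - g ≤ √((-f - g * C) ^ 2 + (k * S) ^ 2) +
      √((g * C - a * u) ^ 2 + (b * v) ^ 2 + (k * S - c * w) ^ 2) := by
  have hf : 0 < f := hg.trans hgf
  rcases le_total C 0 with hC | hC
  · have hC' : 0 ≤ -C := by linarith
    have hCS' : (-C) ^ 2 - S ^ 2 = 1 := by rwa [neg_sq]
    have h₁ := dist_focus_focalHyperbola hgf hf hfg hC' hCS'
    have h₂ := le_dist_focalHyperbola hg hgf hfa haf hbk hfg hP hs hC' hCS'
    rw [neg_mul_neg] at h₁ h₂
    linarith
  · have h₁ : √((-f - g * C) ^ 2 + (k * S) ^ 2) = f * C + g := by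
      rw [← Real.sqrt_sq (show 0 ≤ f * C + g by positivity)]
      congr 1
      linear_combination (1 - C ^ 2) * hfg - k ^ 2 * hCS
    set t := √((f * -u + g) ^ 2 + (k * v) ^ 2) with ht
    have ht₂ : t ^ 2 = (f * -u + g) ^ 2 + (k * v) ^ 2 := Real.sq_sqrt (by positivity)
    have ht₀ : 0 ≤ t := Real.sqrt_nonneg _
    have h₂ := le_dist_focalHyperbola hg hgf hfa haf hbk hfg (u := -u) (w := w) (by rwa [neg_sq]) ht₂ hC hCS
    have h₃ : (-g * C - a * -u) ^ 2 = (g * C - a * u) ^ 2 := by ring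
    rw [h₃] at h₂
    have h₄ : f * u - g ≤ t :=
      (abs_le_of_sq_le_sq' (by nlinarith [sq_nonneg (k * v)]) ht₀).2
    have h₅ : s ≤ t + 2 * g := (abs_le_of_sq_le_sq' (by nlinarith) (by linarith)).2
    linarith

/-- The distance from the right focus of the focal ellipse to one of its points. -/
lemma dist_focus_focalEllipse {f g k p q : ℝ} (hg : 0 < g) (hgf : g < f)
    (hfg : f ^ 2 = g ^ 2 + k ^ 2) (hpq : p ^ 2 + q ^ 2 = 1) :
    √((f * p - g) ^ 2 + (k * q) ^ 2) = f - g * p := by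
  have hp : p ≤ 1 := by nlinarith [sq_nonneg q]
  rw [← Real.sqrt_sq (show 0 ≤ f - g * p by nlinarith)]
  congr 1
  linear_combination (p ^ 2 - 1) * hfg + k ^ 2 * hpq

lemma norm_sub_eq_sqrt_fin_three (X Y : EuclideanSpace ℝ (Fin 3)) :
    ‖X - Y‖ = √((X 0 - Y 0) ^ 2 + (X 1 - Y 1) ^ 2 + (X 2 - Y 2) ^ 2) := by
  simp [EuclideanSpace.norm_eq, Fin.sum_univ_three]

/-- Staude's wire-model theorem: for every point `P` of the ellipsoid
`x²/a² + y²/b² + z²/c² = 1` (`0 < c < b < a`), the shortest total length of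
broken lines `F₁ H P E G₂` with `H` on the focal hyperbola and `E` on the
focal ellipse, where `F₁ = (−√(a²−c²), 0, 0)` is the left focus of the focal
hyperbola and `G₂ = (√(a²−b²), 0, 0)` is the right focus of the focal ellipse,
equals `2a + √(a²−c²) − √(a²−b²)`, independently of the position of `P`. -/
theorem staude_wire_model
    (a b c : ℝ) (hc : 0 < c) (hcb : c < b) (hba : b < a)
    (P : EuclideanSpace ℝ (Fin 3))
    (hP : (P 0) ^ 2 / a ^ 2 + (P 1) ^ 2 / b ^ 2 + (P 2) ^ 2 / c ^ 2 = 1)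
    (F₁ G₂ : EuclideanSpace ℝ (Fin 3))
    (hF₁ : F₁ = ![-Real.sqrt (a ^ 2 - c ^ 2), 0, 0])
    (hG₂ : G₂ = ![Real.sqrt (a ^ 2 - b ^ 2), 0, 0]) :
    sInf {r : ℝ | ∃ H : EuclideanSpace ℝ (Fin 3),
        ((H 0) ^ 2 / (a ^ 2 - b ^ 2) - (H 2) ^ 2 / (b ^ 2 - c ^ 2) = 1
          ∧ H 1 = 0) ∧
        ∃ E : EuclideanSpace ℝ (Fin 3),
          ((E 0) ^ 2 / (a ^ 2 - c ^ 2) + (E 1) ^ 2 / (b ^ 2 - c ^ 2) = 1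
            ∧ E 2 = 0) ∧
          r = ‖F₁ - H‖ + ‖H - P‖ + ‖P - E‖ + ‖E - G₂‖}
      = 2 * a + Real.sqrt (a ^ 2 - c ^ 2) - Real.sqrt (a ^ 2 - b ^ 2) := by
  have ha : 0 < a := by linarith
  have hb : 0 < b := by linarith
  have hf₀ : 0 < a ^ 2 - c ^ 2 := by nlinarith
  have hg₀ : 0 < a ^ 2 - b ^ 2 := by nlinarith
  have hk₀ : 0 < b ^ 2 - c ^ 2 := by nlinarith
  have hf₂ := Real.sq_sqrt hf₀.le
  have hg₂ := Real.sq_sqrt hg₀.le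
  have hk₂ := Real.sq_sqrt hk₀.le
  have hf := Real.sqrt_pos.2 hf₀
  have hg := Real.sqrt_pos.2 hg₀
  have hk := Real.sqrt_pos.2 hk₀
  set f := √(a ^ 2 - c ^ 2)
  set g := √(a ^ 2 - b ^ 2)
  set k := √(b ^ 2 - c ^ 2)
  rw [← hf₂, ← hg₂, ← hk₂]
  have haf : a ^ 2 = c ^ 2 + f ^ 2 := by linarith
  have hbk : b ^ 2 = c ^ 2 + k ^ 2 := by linarith
  have hfg : f ^ 2 = g ^ 2 + k ^ 2 := by linarith
  have hgf : g < f := by nlinarith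
  have hfa : f < a := by nlinarith
  have hF0 : F₁ 0 = -f := by rw [hF₁]; rfl
  have hF1 : F₁ 1 = 0 := by rw [hF₁]; rfl
  have hF2 : F₁ 2 = 0 := by rw [hF₁]; rfl
  have hG0 : G₂ 0 = g := by rw [hG₂]; rfl
  have hG1 : G₂ 1 = 0 := by rw [hG₂]; rfl
  have hG2 : G₂ 2 = 0 := by rw [hG₂]; rfl
  obtain ⟨u, hu⟩ : ∃ u, P 0 = a * u := ⟨P 0 / a, by field_simp⟩
  obtain ⟨v, hv⟩ : ∃ v, P 1 = b * v := ⟨P 1 / b, by field_simp⟩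
  obtain ⟨w, hw⟩ : ∃ w, P 2 = c * w := ⟨P 2 / c, by field_simp⟩
  replace hP : u ^ 2 + v ^ 2 + w ^ 2 = 1 := by
    rw [← hP, hu, hv, hw]
    field_simp
  obtain ⟨s, hs₀, hs⟩ : ∃ s : ℝ, 0 ≤ s ∧ s ^ 2 = (f * u + g) ^ 2 + (k * v) ^ 2 :=
    ⟨√((f * u + g) ^ 2 + (k * v) ^ 2), Real.sqrt_nonneg _, Real.sq_sqrt (by positivity)⟩
  refine IsLeast.csInf_eq ⟨?_, ?_⟩
  · obtain ⟨C, S, hC, hCS, hH⟩ :=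
      exists_dist_focalHyperbola_eq hg hgf hfa haf hbk hfg hP hs₀ hs
    obtain ⟨p, q, hpq, hE⟩ :=
      exists_dist_focalEllipse_eq hg (hgf.trans hfa) haf hbk hfg hP hs₀ hs
    refine ⟨!₂[-g * C, 0, k * S], ⟨?_, by simp⟩, !₂[f * p, k * q, 0], ⟨?_, by simp⟩, ?_⟩
    · simp only [Matrix.cons_val]
      field_simp
      linarith
    · simp only [Matrix.cons_val]
      field_simp
      linarith
    · simp only [norm_sub_eq_sqrt_fin_three, hF0, hF1, hF2, hG0, hG1, hG2, hu, hv, hw,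
        Matrix.cons_val, sub_zero, zero_sub, neg_sq, sub_self, ne_eq,
        OfNat.ofNat_ne_zero, not_false_eq_true, zero_pow, add_zero]
      rw [dist_focus_focalHyperbola hgf hf hfg hC hCS, hH, hE,
        dist_focus_focalEllipse hg hgf hfg hpq]
      ring
  · rintro r ⟨H, ⟨hH, hH1⟩, E, ⟨hE, hE2⟩, rfl⟩
    obtain ⟨C, hC⟩ : ∃ C, H 0 = g * C := ⟨H 0 / g, by field_simp⟩
    obtain ⟨S, hS⟩ : ∃ S, H 2 = k * S := ⟨H 2 / k, by field_simp⟩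
    obtain ⟨p, hp⟩ : ∃ p, E 0 = f * p := ⟨E 0 / f, by field_simp⟩
    obtain ⟨q, hq⟩ : ∃ q, E 1 = k * q := ⟨E 1 / k, by field_simp⟩
    have hCS : C ^ 2 - S ^ 2 = 1 := by
      rw [← hH, hC, hS]
      field_simp
    have hpq : p ^ 2 + q ^ 2 = 1 := by
      rw [← hE, hp, hq]
      field_simp
    have h₁ := le_brokenLine_focalHyperbola hg hgf hfa haf hbk hfg hP hs hCS
    have h₂ := le_dist_focalEllipse hg (hgf.trans hfa) haf hbk hfg hP hs₀ hs hpq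
    have h₃ := dist_focus_focalEllipse hg hgf hfg hpq
    simp only [norm_sub_eq_sqrt_fin_three, hF0, hF1, hF2, hG0, hG1, hG2, hu, hv, hw, hC, hS, hH1,
      hp, hq, hE2, sub_zero, zero_sub, neg_sq, sub_self, ne_eq,
      OfNat.ofNat_ne_zero, not_false_eq_true, zero_pow, add_zero]
    linarith
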